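/- Let n ≥ 2, ker = {β ∈ ℤ : |β| ≤ k}, and let v = (v_β)_{β∈ker} be nonnegative reals with Σ_β v_β = 1. Define A_v ⋆ on n×n matrices by [A_v ⋆ C]_{α,α'} = Σ_{β∈ker} v_β C_{α+β, α'+β}, indices mod n. Let 0 ≤ χ_c < 1 and 0 ≤ χ_q < 1 with χ_q ≠ χ_c, let κ ∈ ℝ, and let J be the linear map on symmetric n×n matrices with J V_{α,α'} = χ_c V_{α,α'} (α ≠ α') and J V_{α,α} = χ_q V_{α,α} + κ Σ_{α'≠α} V_{α,α'}. Set L = (A_v ⋆) ∘ J. Then for every symmetric n×n matrix U, L^m(U) → 0 as m → ∞. -/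

import Mathlib

/-- The circular cross-correlation operator `[A_v ⋆ C]_{α,α'} = ∑_β v_β C_{α+β,α'+β}`. -/
noncomputable def aveOp (n k : ℕ) (v : ℤ → ℝ) (C : Matrix (ZMod n) (ZMod n) ℝ) :
    Matrix (ZMod n) (ZMod n) ℝ :=
  Matrix.of fun α α' =>
    ∑ β ∈ Finset.Icc (-(k : ℤ)) (k : ℤ), v β * C (α + (β : ZMod n)) (α' + (β : ZMod n))

/-- Canonical symmetric basis matrix `V_{α,α'}`. -/
noncomputable def Vb (n : ℕ) (α α' : ZMod n) : Matrix (ZMod n) (ZMod n) ℝ :=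
  Matrix.of fun a b =>
    if (a = α ∧ b = α') ∨ (a = α' ∧ b = α) then (1 : ℝ) else 0

theorem Vb_diag (n : ℕ) (α α' a : ZMod n) :
    Vb n α α' a a = (if α = a then (if α' = a then (1:ℝ) else 0) else 0) := by
  simp only [Vb, Matrix.of_apply]
  split_ifs <;> grind

theorem Vb_off (n : ℕ) (α α' a b : ZMod n) (hab : a ≠ b) :
    Vb n α α' a b = (if α = a then (if α' = b then (1:ℝ) else 0) else 0)
      + (if α = b then (if α' = a then (1:ℝ) else 0) else 0) := by
  simp only [Vb, Matrix.of_apply]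
  split_ifs <;> grind

theorem symm_decomp (n : ℕ) [NeZero n] (U : Matrix (ZMod n) (ZMod n) ℝ) (hU : U.IsSymm) :
    U = ∑ α, ∑ α', (if α = α' then U α α' else U α α' / 2) • Vb n α α' := by
  ext a b
  simp only [Matrix.sum_apply, Matrix.smul_apply, smul_eq_mul]
  by_cases hab : a = b
  · subst hab
    simp [Vb_diag]
  · have := hU.apply a b
    simp [Vb_off n _ _ a b hab, mul_add, Finset.sum_add_distrib, hab, Ne.symm hab]
    linarith

theorem J_apply (n : ℕ) [NeZero n] (χc χq κ : ℝ)
    (J : Matrix (ZMod n) (ZMod n) ℝ →ₗ[ℝ] Matrix (ZMod n) (ZMod n) ℝ)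
    (hod : ∀ α α' : ZMod n, α ≠ α' → J (Vb n α α') = χc • Vb n α α')
    (hdg : ∀ α : ZMod n,
      J (Vb n α α) =
        χq • Vb n α α + κ • ∑ α' ∈ Finset.univ.filter (· ≠ α), Vb n α α')
    (U : Matrix (ZMod n) (ZMod n) ℝ) (hU : U.IsSymm) (a b : ZMod n) :
    J U a b = if a = b then χq * U a a else χc * U a b + κ * (U a a + U b b) := by
  have hJ : ∀ α α', J (Vb n α α') a b = χc * Vb n α α' a b +
      if α = α' then ((χq - χc) * Vb n α α a b
        + κ * ∑ γ, if γ = α then 0 else Vb n α γ a b) else 0 := by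
    intro α α'
    by_cases h : α = α'
    · subst h
      rw [hdg]
      simp only [Matrix.add_apply, Matrix.smul_apply, Matrix.sum_apply, smul_eq_mul,
        Finset.sum_filter, if_true, ne_eq, ite_not]
      have : ∀ γ, (if γ = α then (0 : Matrix (ZMod n) (ZMod n) ℝ) else Vb n α γ) a b
          = if γ = α then 0 else Vb n α γ a b := by
        intro γ
        split_ifs <;> rfl
      simp only [this]
      ring
    · rw [hod _ _ h]
      simp [h]
  have hd : U a b = ∑ α, ∑ α', (if α = α' then U α α' else U α α' / 2) * Vb n α α' a b := by
    conv_lhs => rw [symm_decomp n U hU]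
    simp only [Matrix.sum_apply, Matrix.smul_apply, smul_eq_mul]
  have h1 : J U a b = χc * U a b + ∑ α, U α α * ((χq - χc) * Vb n α α a b
        + κ * ∑ γ, if γ = α then 0 else Vb n α γ a b) := by
    conv_lhs => rw [symm_decomp n U hU]
    simp only [map_sum, map_smul, Matrix.sum_apply, Matrix.smul_apply, smul_eq_mul, hJ]
    rw [hd]
    simp only [mul_add, Finset.sum_add_distrib, Finset.mul_sum]
    congr 1
    · refine Finset.sum_congr rfl fun α _ => Finset.sum_congr rfl fun α' _ => by ring
    · simp [mul_add, Finset.sum_add_distrib, Finset.mul_sum]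
  rw [h1]
  by_cases hab : a = b
  · subst hab
    have h0 : ∀ α, (∑ γ, if γ = α then 0 else Vb n α γ a a) = 0 := by
      intro α
      refine Finset.sum_eq_zero fun γ _ => ?_
      rw [Vb_diag]
      split_ifs <;> grind
    simp only [h0]
    simp [Vb_diag]
    ring
  · have h0 : ∀ α, (∑ γ, if γ = α then 0 else Vb n α γ a b)
        = (if α = a then 1 else 0) + (if α = b then 1 else 0) := by
      intro α
      have : ∀ γ, (if γ = α then 0 else Vb n α γ a b) =
          (if γ = b then (if α = a then (1:ℝ) else 0) else 0)
          + (if γ = a then (if α = b then (1:ℝ) else 0) else 0) := by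
        intro γ
        rw [Vb_off n _ _ a b hab]
        split_ifs <;> grind
      simp only [this, Finset.sum_add_distrib]
      simp
    have h2 : ∀ α, Vb n α α a b = 0 := by
      intro α
      rw [Vb_off n _ _ a b hab]
      split_ifs <;> grind
    simp only [h0, h2, hab, if_false]
    simp [mul_add, Finset.sum_add_distrib]
    ring

theorem aveOp_bound (n k : ℕ) (v : ℤ → ℝ)
    (hv : ∀ β ∈ Finset.Icc (-(k : ℤ)) (k : ℤ), 0 ≤ v β)
    (hv1 : ∑ β ∈ Finset.Icc (-(k : ℤ)) (k : ℤ), v β = 1)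
    (C : Matrix (ZMod n) (ZMod n) ℝ) (B : ℝ) (a b : ZMod n)
    (h : ∀ g, |C (a + g) (b + g)| ≤ B) : |aveOp n k v C a b| ≤ B := by
  simp only [aveOp, Matrix.of_apply]
  calc _ ≤ ∑ β ∈ Finset.Icc (-(k : ℤ)) (k : ℤ), |v β * C (a + (β : ZMod n)) (b + (β : ZMod n))| :=
        Finset.abs_sum_le_sum_abs _ _
    _ ≤ ∑ β ∈ Finset.Icc (-(k : ℤ)) (k : ℤ), v β * B := by
        refine Finset.sum_le_sum fun β hβ => ?_
        rw [abs_mul, abs_of_nonneg (hv β hβ)]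
        exact mul_le_mul_of_nonneg_left (h _) (hv β hβ)
    _ = B := by rw [← Finset.sum_mul, hv1, one_mul]

/-- Stability of the mean-field fixed point: if `v` is a probability vector over the
kernel, `0 ≤ χ_c < 1`, `0 ≤ χ_q < 1`, `χ_q ≠ χ_c`, and `J` is the C-map Jacobian
(with `J V_{α,α'} = χ_c V_{α,α'}` for `α ≠ α'` and
`J V_{α,α} = χ_q V_{α,α} + κ ∑_{α'≠α} V_{α,α'}`), then all iterates of
`L = (A_v ⋆) ∘ J` applied to any symmetric matrix converge to `0`. -/
theorem stmt12
    (n k : ℕ) [NeZero n] (hn : 2 ≤ n) (v : ℤ → ℝ)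
    (hv : ∀ β ∈ Finset.Icc (-(k : ℤ)) (k : ℤ), 0 ≤ v β)
    (hv1 : ∑ β ∈ Finset.Icc (-(k : ℤ)) (k : ℤ), v β = 1)
    (χc χq κ : ℝ)
    (hχc0 : 0 ≤ χc) (hχc1 : χc < 1) (hχq0 : 0 ≤ χq) (hχq1 : χq < 1) (hne : χq ≠ χc)
    (J : Matrix (ZMod n) (ZMod n) ℝ →ₗ[ℝ] Matrix (ZMod n) (ZMod n) ℝ)
    (hod : ∀ α α' : ZMod n, α ≠ α' → J (Vb n α α') = χc • Vb n α α')
    (hdg : ∀ α : ZMod n,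
      J (Vb n α α) =
        χq • Vb n α α + κ • ∑ α' ∈ Finset.univ.filter (· ≠ α), Vb n α α')
    (U : Matrix (ZMod n) (ZMod n) ℝ) (hU : U.IsSymm) :
    Filter.Tendsto (fun m : ℕ => (fun X => aveOp n k v (J X))^[m] U)
      Filter.atTop (nhds 0) := by
  obtain ⟨ρ, hρ, hρ1⟩ : ∃ ρ, max χc χq < ρ ∧ ρ < 1 := exists_between (max_lt hχc1 hχq1)
  have hρc : χc < ρ := lt_of_le_of_lt (le_max_left _ _) hρ
  have hρq : χq < ρ := lt_of_le_of_lt (le_max_right _ _) hρ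
  have hρ0 : 0 ≤ ρ := hχc0.trans hρc.le
  obtain ⟨w, hw1, hw⟩ : ∃ w : ℝ, 1 ≤ w ∧ 2 * |κ| ≤ w * (ρ - χc) := by
    refine ⟨max 1 (2 * |κ| / (ρ - χc)), le_max_left _ _, ?_⟩
    rw [← div_le_iff₀ (sub_pos.2 hρc)]
    exact le_max_right _ _
  obtain ⟨M, hM0, hM⟩ : ∃ M : ℝ, 0 ≤ M ∧ ∀ a b, |U a b| ≤ M := by
    refine ⟨∑ a, ∑ b, |U a b|, by positivity, fun a b => ?_⟩
    calc |U a b| ≤ ∑ b, |U a b| :=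
          Finset.single_le_sum (f := fun b => |U a b|) (fun _ _ => abs_nonneg _) (Finset.mem_univ b)
      _ ≤ _ := Finset.single_le_sum (f := fun a => ∑ b, |U a b|)
          (fun _ _ => by positivity) (Finset.mem_univ a)
  have key : ∀ m : ℕ, ((fun X => aveOp n k v (J X))^[m] U).IsSymm ∧
      (∀ a, |((fun X => aveOp n k v (J X))^[m] U) a a| ≤ M * ρ ^ m) ∧
      (∀ a b, a ≠ b → |((fun X => aveOp n k v (J X))^[m] U) a b| ≤ w * (M * ρ ^ m)) := by
    intro m
    induction m with
    | zero =>
      refine ⟨hU, fun a => by simpa using hM a a, fun a b _ => ?_⟩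
      have := hM a b
      simp only [Function.iterate_zero, id, pow_zero, mul_one]
      nlinarith
    | succ m ih =>
      rw [Function.iterate_succ_apply']
      generalize (fun X => aveOp n k v (J X))^[m] U = X at ih
      obtain ⟨hs, h1, h2⟩ := ih
      have hJ := J_apply n χc χq κ J hod hdg X hs
      have hB : 0 ≤ M * ρ ^ m := by positivity
      refine ⟨?_, fun a => ?_, fun a b hab => ?_⟩
      · ext a b
        simp only [Matrix.transpose_apply, aveOp, Matrix.of_apply]
        refine Finset.sum_congr rfl fun β _ => ?_
        rw [hJ, hJ, hs.apply (a + (β : ZMod n)) (b + (β : ZMod n))]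
        by_cases hab : a = b
        · simp [hab]
        · simp [hab, Ne.symm hab]
          left
          left
          ring
      · refine aveOp_bound n k v hv hv1 _ _ _ _ fun g => ?_
        rw [hJ, if_pos rfl, abs_mul, abs_of_nonneg hχq0, pow_succ]
        have := mul_le_mul hρq.le (h1 (a + g)) (abs_nonneg _) hρ0
        linarith
      · refine aveOp_bound n k v hv hv1 _ _ _ _ fun g => ?_
        have hg : a + g ≠ b + g := fun h => hab (add_right_cancel h)
        rw [hJ, if_neg hg]
        have e1 := mul_le_mul_of_nonneg_left (h2 _ _ hg) hχc0
        have e2 := mul_le_mul_of_nonneg_left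
          ((abs_add_le (X (a + g) (a + g)) (X (b + g) (b + g))).trans
            (add_le_add (h1 (a + g)) (h1 (b + g)))) (abs_nonneg κ)
        have e3 := mul_le_mul_of_nonneg_right hw hB
        refine (abs_add_le _ _).trans ?_
        rw [abs_mul, abs_mul, abs_of_nonneg hχc0, pow_succ]
        linarith
  have hlim : Filter.Tendsto (fun m : ℕ => w * (M * ρ ^ m)) Filter.atTop (nhds 0) := by
    simpa using ((tendsto_pow_atTop_nhds_zero_of_lt_one hρ0 hρ1).const_mul M).const_mul w
  refine tendsto_pi_nhds.2 fun a => tendsto_pi_nhds.2 fun b => ?_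
  refine squeeze_zero_norm (fun m => ?_) hlim
  rw [Real.norm_eq_abs]
  by_cases hab : a = b
  · subst hab
    have hB : 0 ≤ M * ρ ^ m := by positivity
    have := (key m).2.1 a
    nlinarith
  · exact (key m).2.2 a b hab
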